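/- arXiv:2305.08425 — 3 statements merged into one kernel-verified Lean document; each statement's English description precedes it below -/
import Mathlib

section
/- Let φ : ℝ → [0,+∞) be even, convex, with φ(0) = 0, and assume there exists a constant K₀ > 2 such that φ(2r) ≥ K₀ φ(r) for all r ≥ 0. Then the convex conjugate φ*(s) := sup_{r∈ℝ}(r s − φ(r)) satisfies the Δ2-condition: there exists K ≥ 2 such that φ*(2s) ≤ K φ*(s) for all s ≥ 0. More precisely, φ*(s) ≥ K₀⁻¹ φ*((K₀/2) s) for all s ≥ 0, and consequently φ*(2s) ≤ K₀^{n₀} φ*(s) for all s ≥ 0, where n₀ ∈ ℕ is chosen so that (K₀/2)^{n₀−1} < 2 ≤ (K₀/2)^{n₀}. -/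
open ENNReal

/-- The convex conjugate `φ*(s) = sup_r (r s − φ r)` of a non-negative function with
`φ 0 = 0`, realized with values in `[0,+∞]`. -/
noncomputable def conjFn (φ : ℝ → ℝ) (s : ℝ) : ℝ≥0∞ :=
  ⨆ r : ℝ, ENNReal.ofReal (r * s - φ r)

theorem conjFn_mono_of_even {φ : ℝ → ℝ} (heven : ∀ r : ℝ, φ (-r) = φ r) {a b : ℝ}
    (ha : 0 ≤ a) (hab : a ≤ b) : conjFn φ a ≤ conjFn φ b := by
  refine iSup_le fun r => le_iSup_of_le |r| (ENNReal.ofReal_le_ofReal ?_)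
  have habs : φ |r| = φ r := by
    rcases abs_choice r with h | h <;> rw [h]
    exact heven r
  have h₁ : r * a ≤ |r| * a := mul_le_mul_of_nonneg_right (le_abs_self r) ha
  have h₂ : |r| * a ≤ |r| * b := mul_le_mul_of_nonneg_left hab (abs_nonneg r)
  linarith

theorem conjFn_half_mul_le {φ : ℝ → ℝ} {K : ℝ} (hK : 0 ≤ K)
    (hφ : ∀ r : ℝ, K * φ r ≤ φ (2 * r)) (s : ℝ) :
    conjFn φ (K / 2 * s) ≤ ENNReal.ofReal K * conjFn φ s := by
  refine iSup_le fun r => ?_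
  calc ENNReal.ofReal (r * (K / 2 * s) - φ r)
      ≤ ENNReal.ofReal (K * (r / 2 * s - φ (r / 2))) := by
        refine ENNReal.ofReal_le_ofReal ?_
        have h := hφ (r / 2)
        rw [mul_div_cancel₀ r two_ne_zero] at h
        linarith
    _ = ENNReal.ofReal K * ENNReal.ofReal (r / 2 * s - φ (r / 2)) := ENNReal.ofReal_mul hK
    _ ≤ ENNReal.ofReal K * conjFn φ s :=
        mul_le_mul_right (le_iSup (fun r => ENNReal.ofReal (r * s - φ r)) (r / 2)) _

theorem conjFn_half_pow_mul_le {φ : ℝ → ℝ} {K : ℝ} (hK : 0 ≤ K)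
    (hφ : ∀ r : ℝ, K * φ r ≤ φ (2 * r)) (s : ℝ) (n : ℕ) :
    conjFn φ ((K / 2) ^ n * s) ≤ ENNReal.ofReal (K ^ n) * conjFn φ s := by
  induction n with
  | zero => simp
  | succ n ih =>
    rw [pow_succ', mul_assoc, pow_succ', ENNReal.ofReal_mul hK, mul_assoc]
    exact (conjFn_half_mul_le hK hφ _).trans (mul_le_mul_right ih _)

/-- if `φ` is even, convex, `φ 0 = 0` and `φ(2r) ≥ K₀ φ(r)` with `K₀ > 2`,
then `φ*` satisfies the Δ₂-condition; precisely `φ*(s) ≥ K₀⁻¹ φ*((K₀/2)s)` for all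
`s ≥ 0`, and `φ*(2s) ≤ K₀^{n₀} φ*(s)` when `(K₀/2)^{n₀−1} < 2 ≤ (K₀/2)^{n₀}`. -/
theorem stmt3 (φ : ℝ → ℝ) (K₀ : ℝ)
    (hnonneg : ∀ r : ℝ, 0 ≤ φ r)
    (heven : ∀ r : ℝ, φ (-r) = φ r)
    (hconv : ConvexOn ℝ Set.univ φ)
    (h0 : φ 0 = 0)
    (hK₀ : 2 < K₀)
    (hlow : ∀ r : ℝ, 0 ≤ r → K₀ * φ r ≤ φ (2 * r)) :
    (∃ K : ℝ, 2 ≤ K ∧ ∀ s : ℝ, 0 ≤ s → conjFn φ (2 * s) ≤ ENNReal.ofReal K * conjFn φ s) ∧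
    (∀ s : ℝ, 0 ≤ s → ENNReal.ofReal K₀⁻¹ * conjFn φ (K₀ / 2 * s) ≤ conjFn φ s) ∧
    (∀ n₀ : ℕ, (K₀ / 2) ^ (n₀ - 1) < 2 → 2 ≤ (K₀ / 2) ^ n₀ →
      ∀ s : ℝ, 0 ≤ s → conjFn φ (2 * s) ≤ ENNReal.ofReal (K₀ ^ n₀) * conjFn φ s) := by
  have hK : 0 < K₀ := by linarith
  have hφ : ∀ r : ℝ, K₀ * φ r ≤ φ (2 * r) := by
    intro r
    rcases le_total 0 r with hr | hr
    · exact hlow r hr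
    · have h := hlow (-r) (neg_nonneg.2 hr)
      rwa [mul_neg, heven, heven] at h
  have hdouble : ∀ n : ℕ, 2 ≤ (K₀ / 2) ^ n → ∀ s : ℝ, 0 ≤ s →
      conjFn φ (2 * s) ≤ ENNReal.ofReal (K₀ ^ n) * conjFn φ s := fun n hn s hs =>
    (conjFn_mono_of_even heven (by positivity) (mul_le_mul_of_nonneg_right hn hs)).trans
      (conjFn_half_pow_mul_le hK.le hφ s n)
  refine ⟨?_, fun s _ => ?_, fun n _ hn => hdouble n hn⟩
  · obtain ⟨n, hn⟩ := pow_unbounded_of_one_lt (2 : ℝ) (show 1 < K₀ / 2 by linarith)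
    exact ⟨K₀ ^ n, hn.le.trans (pow_le_pow_left₀ (by positivity) (by linarith) n),
      hdouble n hn.le⟩
  · calc ENNReal.ofReal K₀⁻¹ * conjFn φ (K₀ / 2 * s)
        ≤ ENNReal.ofReal K₀⁻¹ * (ENNReal.ofReal K₀ * conjFn φ s) :=
          mul_le_mul_right (conjFn_half_mul_le hK.le hφ s) _
      _ = conjFn φ s := by
          rw [← mul_assoc, ← ENNReal.ofReal_mul (inv_nonneg.2 hK.le), inv_mul_cancel₀ hK.ne',
            ENNReal.ofReal_one, one_mul]
end

section
/- Let (Ω,μ) be a measure space and φ : Ω × [0,+∞) → [0,+∞) be such that for a.e. x the function φ(x,·) is convex with φ(x,0) = 0, for every r ≥ 0 the function φ(·,r) is measurable, and there exists K₀ > 2 with φ(x,2r) ≥ K₀ φ(x,r) for all r ≥ 0 and a.e. x. For measurable u : Ω → ℝ define ρ(u) := ∫_Ω φ(x,|u(x)|) dμ and ‖u‖_φ := inf{λ > 0 : ρ(u/λ) ≤ 1}. Let C ≥ 1 and let u be a measurable function with ‖u‖_φ < +∞ satisfying ρ(u) ≤ C(‖u‖_φ + 1). Then either ‖u‖_φ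 ≤ 1 or ‖u‖_φ ≤ (2 C K₀)^{1/log₂(K₀/2)}. In particular, any family of functions L satisfying ρ(u) ≤ C(‖u‖_φ + 1) for all u ∈ L is bounded in the Luxemburg norm. -/
open MeasureTheory ENNReal

variable {Ω : Type*} [MeasurableSpace Ω]

/-- The Musielak-Orlicz modular `ρ(u) = ∫_Ω φ(x,|u(x)|) dμ`. -/
noncomputable def modularMO (μ : Measure Ω) (φ : Ω → ℝ → ℝ) (u : Ω → ℝ) : ℝ≥0∞ :=
  ∫⁻ x, ENNReal.ofReal (φ x |u x|) ∂μ

/-- The Luxemburg norm `‖u‖_φ = inf {λ > 0 : ρ(u/λ) ≤ 1}` (with `inf ∅ = +∞`),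
realized with values in `[0,+∞]`. -/
noncomputable def luxNorm (μ : Measure Ω) (φ : Ω → ℝ → ℝ) (u : Ω → ℝ) : ℝ≥0∞ :=
  sInf {l : ℝ≥0∞ | ∃ c : ℝ, 0 < c ∧ l = ENNReal.ofReal c ∧
    modularMO μ φ (fun x => u x / c) ≤ 1}

/-- Iterating the bound `K₀ * f r ≤ f (2 * r)`. -/
theorem pow_mul_le_of_mul_le_two_mul {f : ℝ → ℝ} {K₀ : ℝ} (hK₀ : 0 ≤ K₀)
    (hf : ∀ r : ℝ, 0 ≤ r → K₀ * f r ≤ f (2 * r)) (j : ℕ) {r : ℝ} (hr : 0 ≤ r) :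
    K₀ ^ j * f r ≤ f (2 ^ j * r) := by
  induction j with
  | zero => simp
  | succ j ih =>
    calc K₀ ^ (j + 1) * f r = K₀ * (K₀ ^ j * f r) := by ring
      _ ≤ K₀ * f (2 ^ j * r) := mul_le_mul_of_nonneg_left ih hK₀
      _ ≤ f (2 * (2 ^ j * r)) := hf _ (by positivity)
      _ = f (2 ^ (j + 1) * r) := by ring_nf

/-- A nonnegative convex function on `[0, ∞)` vanishing at `0` is monotone. -/
theorem ConvexOn.monotoneOn_Ici_of_zero {f : ℝ → ℝ} (hf : ConvexOn ℝ (Set.Ici 0) f)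
    (h_zero : f 0 = 0) (h_nonneg : ∀ r : ℝ, 0 ≤ r → 0 ≤ f r) :
    MonotoneOn f (Set.Ici 0) := by
  intro s hs t ht hst
  have h0s : (0 : ℝ) ≤ s := hs
  rcases h0s.eq_or_lt with rfl | hs_pos
  · rw [h_zero]
    exact h_nonneg t ht
  · have ht_pos : 0 < t := hs_pos.trans_le hst
    have hle : s / t ≤ 1 := (div_le_one ht_pos).2 hst
    have key := hf.2 ht (Set.mem_Ici.2 (le_refl (0 : ℝ))) (by positivity : 0 ≤ s / t)
      (sub_nonneg.2 hle) (add_sub_cancel _ _)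
    simp only [smul_eq_mul, mul_zero, add_zero, h_zero, div_mul_cancel₀ s ht_pos.ne'] at key
    exact key.trans (mul_le_of_le_one_left (h_nonneg t ht) hle)

theorem rpow_logb_two_le_mul_pow {K₀ c : ℝ} (hK₀ : 1 < K₀) (hc : 0 ≤ c) {j : ℕ}
    (hcj : c ≤ 2 ^ (j + 1)) : c ^ Real.logb 2 K₀ ≤ K₀ * K₀ ^ j := by
  calc c ^ Real.logb 2 K₀ ≤ ((2 : ℝ) ^ (j + 1)) ^ Real.logb 2 K₀ :=
        Real.rpow_le_rpow hc hcj (Real.logb_nonneg (by norm_num) hK₀.le)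
    _ = ((2 : ℝ) ^ Real.logb 2 K₀) ^ (j + 1) := by
        rw [← Real.rpow_natCast, ← Real.rpow_natCast, ← Real.rpow_mul (by norm_num),
          ← Real.rpow_mul (by norm_num), mul_comm]
    _ = K₀ * K₀ ^ j := by
        rw [Real.rpow_logb (by norm_num) (by norm_num) (by linarith), pow_succ']

/-- Scaling of the modular by a factor `c ≥ 1`. -/
theorem mul_modularMO_div_le (μ : Measure Ω) {φ : Ω → ℝ → ℝ} {K₀ : ℝ} (hK₀ : 1 < K₀)
    (hφ : ∀ᵐ x ∂μ, ConvexOn ℝ (Set.Ici 0) (φ x) ∧ φ x 0 = 0 ∧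
      (∀ r : ℝ, 0 ≤ r → 0 ≤ φ x r) ∧ (∀ r : ℝ, 0 ≤ r → K₀ * φ x r ≤ φ x (2 * r)))
    (u : Ω → ℝ) {c : ℝ} (hc : 1 ≤ c) :
    ENNReal.ofReal (c ^ Real.logb 2 K₀ / K₀) * modularMO μ φ (fun x => u x / c) ≤
      modularMO μ φ u := by
  obtain ⟨j, hj, hj'⟩ := exists_nat_pow_near hc (one_lt_two (α := ℝ))
  have hc0 : 0 < c := by linarith
  have hK : 0 < K₀ := by linarith
  refine (lintegral_const_mul_le _ _).trans (lintegral_mono_ae ?_)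
  filter_upwards [hφ] with x ⟨hconv, h_zero, h_nonneg, hdouble⟩
  rw [← ENNReal.ofReal_mul (by positivity)]
  refine ENNReal.ofReal_le_ofReal ?_
  have hr : 0 ≤ |u x / c| := abs_nonneg _
  have hle : (2 : ℝ) ^ j * |u x / c| ≤ |u x| := by
    rw [abs_div, abs_of_pos hc0, mul_div_assoc', div_le_iff₀ hc0, mul_comm]
    exact mul_le_mul_of_nonneg_left hj (abs_nonneg _)
  have hcoef : c ^ Real.logb 2 K₀ / K₀ ≤ K₀ ^ j := by
    rw [div_le_iff₀' hK]
    exact rpow_logb_two_le_mul_pow hK₀ hc0.le hj'.le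
  calc c ^ Real.logb 2 K₀ / K₀ * φ x |u x / c| ≤ K₀ ^ j * φ x |u x / c| :=
        mul_le_mul_of_nonneg_right hcoef (h_nonneg _ hr)
    _ ≤ φ x (2 ^ j * |u x / c|) := pow_mul_le_of_mul_le_two_mul hK.le hdouble j hr
    _ ≤ φ x |u x| := hconv.monotoneOn_Ici_of_zero h_zero h_nonneg
        (Set.mem_Ici.2 (by positivity)) (Set.mem_Ici.2 (abs_nonneg _)) hle

theorem one_lt_modularMO_div_of_lt_luxNorm {μ : Measure Ω} {φ : Ω → ℝ → ℝ} {u : Ω → ℝ} {c : ℝ}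
    (hc : 0 < c) (h : ENNReal.ofReal c < luxNorm μ φ u) :
    1 < modularMO μ φ (fun x => u x / c) := by
  by_contra! hle
  exact h.not_ge (sInf_le ⟨c, hc, rfl, hle⟩)

/-- Lower bound of the modular by a power of a Luxemburg norm larger than `1`. -/
theorem ofReal_rpow_luxNorm_div_le_modularMO (μ : Measure Ω) {φ : Ω → ℝ → ℝ} {K₀ : ℝ}
    (hK₀ : 1 < K₀)
    (hφ : ∀ᵐ x ∂μ, ConvexOn ℝ (Set.Ici 0) (φ x) ∧ φ x 0 = 0 ∧
      (∀ r : ℝ, 0 ≤ r → 0 ≤ φ x r) ∧ (∀ r : ℝ, 0 ≤ r → K₀ * φ x r ≤ φ x (2 * r)))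
    {u : Ω → ℝ} (h_top : luxNorm μ φ u ≠ ⊤) (h_one : 1 < luxNorm μ φ u) :
    ENNReal.ofReal ((luxNorm μ φ u).toReal ^ Real.logb 2 K₀ / K₀) ≤ modularMO μ φ u := by
  set N := (luxNorm μ φ u).toReal with hN
  have hN1 : 1 < N := by
    simpa using (ENNReal.toReal_lt_toReal ENNReal.one_ne_top h_top).2 h_one
  have hcont : ContinuousAt (fun c : ℝ => ENNReal.ofReal (c ^ Real.logb 2 K₀ / K₀)) N :=
    ENNReal.continuous_ofReal.continuousAt.comp
      ((Real.continuousAt_rpow_const N _ (Or.inl (by linarith))).div_const K₀)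
  refine le_of_tendsto (hcont.tendsto.mono_left (nhdsWithin_le_nhds (s := Set.Iio N))) ?_
  filter_upwards [Ioo_mem_nhdsLT hN1] with c hc
  have hlt : ENNReal.ofReal c < luxNorm μ φ u :=
    (ENNReal.ofReal_lt_iff_lt_toReal (by linarith [hc.1]) h_top).2 hc.2
  calc ENNReal.ofReal (c ^ Real.logb 2 K₀ / K₀)
      ≤ ENNReal.ofReal (c ^ Real.logb 2 K₀ / K₀) * modularMO μ φ (fun x => u x / c) :=
        le_mul_of_one_le_right zero_le
          (one_lt_modularMO_div_of_lt_luxNorm (by linarith [hc.1]) hlt).le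
    _ ≤ modularMO μ φ u := mul_modularMO_div_le μ hK₀ hφ u hc.1.le

theorem le_rpow_of_rpow_logb_div_le {K₀ C N : ℝ} (hK₀ : 2 < K₀) (hC : 0 ≤ C) (hN : 1 ≤ N)
    (h : N ^ Real.logb 2 K₀ / K₀ ≤ C * (N + 1)) :
    N ≤ (2 * C * K₀) ^ (1 / Real.logb 2 (K₀ / 2)) := by
  have hK : 0 < K₀ := by linarith
  have hN0 : 0 < N := by linarith
  have hq : 0 < Real.logb 2 (K₀ / 2) := Real.logb_pos (by norm_num) (by linarith)
  have hlog : Real.logb 2 (K₀ / 2) = Real.logb 2 K₀ - 1 := by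
    rw [Real.logb_div hK.ne' (by norm_num), Real.logb_self_eq_one (by norm_num)]
  rw [one_div, Real.le_rpow_inv_iff_of_pos hN0.le (by positivity) hq, hlog,
    Real.rpow_sub_one hN0.ne', div_le_iff₀ hN0]
  rw [div_le_iff₀ hK] at h
  calc N ^ Real.logb 2 K₀ ≤ C * (N + 1) * K₀ := h
    _ ≤ C * (2 * N) * K₀ := by gcongr; linarith
    _ = 2 * C * K₀ * N := by ring

/-- boundedness criterion: under the superlinear bound
`φ(x,2r) ≥ K₀ φ(x,r)` with `K₀ > 2`, any `u` with `ρ(u) ≤ C(‖u‖_φ + 1)` satisfies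
`‖u‖_φ ≤ 1` or `‖u‖_φ ≤ (2CK₀)^{1/log₂(K₀/2)}`; in particular any family satisfying
this modular bound is bounded in the Luxemburg norm. -/
theorem stmt9 (μ : Measure Ω) (φ : Ω → ℝ → ℝ) (K₀ : ℝ)
    (hK₀ : 2 < K₀)
    (hφ : ∀ᵐ x ∂μ, ConvexOn ℝ (Set.Ici 0) (φ x) ∧ φ x 0 = 0 ∧
      (∀ r : ℝ, 0 ≤ r → 0 ≤ φ x r) ∧ (∀ r : ℝ, 0 ≤ r → K₀ * φ x r ≤ φ x (2 * r)))
    (hφmeas : ∀ r : ℝ, Measurable fun x => φ x r)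
    (C : ℝ) (hC : 1 ≤ C)
    (L : Set (Ω → ℝ))
    (hL : ∀ u ∈ L, Measurable u ∧ luxNorm μ φ u < ⊤ ∧
      modularMO μ φ u ≤ ENNReal.ofReal C * (luxNorm μ φ u + 1)) :
    (∀ u ∈ L, luxNorm μ φ u ≤ 1 ∨
      luxNorm μ φ u ≤ ENNReal.ofReal ((2 * C * K₀) ^ (1 / Real.logb 2 (K₀ / 2)))) ∧
    (∃ M : ℝ≥0∞, M < ⊤ ∧ ∀ u ∈ L, luxNorm μ φ u ≤ M) := by
  have h_bound : ∀ u ∈ L, luxNorm μ φ u ≤ 1 ∨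
      luxNorm μ φ u ≤ ENNReal.ofReal ((2 * C * K₀) ^ (1 / Real.logb 2 (K₀ / 2))) := by
    intro u hu
    obtain ⟨-, h_top, h_mod⟩ := hL u hu
    refine or_iff_not_imp_left.2 fun h_one => ?_
    rw [not_le] at h_one
    have h_low := (ofReal_rpow_luxNorm_div_le_modularMO μ (by linarith) hφ h_top.ne h_one).trans
      h_mod
    rw [ENNReal.le_ofReal_iff_toReal_le h_top.ne (by positivity)]
    refine le_rpow_of_rpow_logb_div_le hK₀ (by linarith) ?_ ?_
    · simpa using ENNReal.toReal_mono h_top.ne h_one.le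
    · have h_fin : luxNorm μ φ u + 1 ≠ ⊤ := ENNReal.add_ne_top.2 ⟨h_top.ne, ENNReal.one_ne_top⟩
      have h_real := (ENNReal.ofReal_le_iff_le_toReal
        (ENNReal.mul_ne_top ENNReal.ofReal_ne_top h_fin)).1 h_low
      rwa [ENNReal.toReal_mul, ENNReal.toReal_ofReal (by linarith),
        ENNReal.toReal_add h_top.ne ENNReal.one_ne_top, ENNReal.toReal_one] at h_real
  exact ⟨h_bound, max 1 (ENNReal.ofReal ((2 * C * K₀) ^ (1 / Real.logb 2 (K₀ / 2)))),
    max_lt ENNReal.one_lt_top ENNReal.ofReal_lt_top, fun u hu => le_max_iff.2 (h_bound u hu)⟩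
end

section
/- Let (Ω,μ) be a measure space and φ : Ω × ℝ → [0,+∞) be such that for a.e. x ∈ Ω the function φ(x,·) is convex, even, with φ(x,0) = 0, and satisfies the Δ2-condition φ(x,2r) ≤ K φ(x,r) for all r ≥ 0 with a constant K ≥ 2 independent of x. Let α : Ω × ℝ → ℝ be a Carathéodory function such that for a.e. x and all r, r' ∈ ℝ one has φ(x,r') − φ(x,r) ≥ α(x,r)(r' − r) (i.e. α(x,r) ∈ ∂φ(x,r)). Let u : Ω → ℝ be measurable with ∫_Ω φ(x,|u(x)|) dμ < +∞, and set ξ(x) := α(x,u(x)). Then: (i) ξ·u is integrable and non-negative a.e., with ∫_Ω ξ u dμ ≤ (K−1) ∫_Ω φ(x,|u(x)|) dμ; (ii) ∫_Ω φ*(x,|ξ(x)|) dμ = ∫_Ω ξ u dμ − ∫_Ω φ(x,|u(x)|) dμ < +∞, where φ*(x,s) := sup_{r∈ℝ}(r s − φ(x,r)) is the convex conjugate in the second variable. -/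
open MeasureTheory ENNReal

variable {Ω : Type*} [MeasurableSpace Ω]

/-- The convex conjugate in the second variable,
`φ*(x,s) = sup_r (r s − φ(x,r))`, realized with values in `[0,+∞]`. -/
noncomputable def conjFn2 (φ : Ω → ℝ → ℝ) (x : Ω) (s : ℝ) : ℝ≥0∞ :=
  ⨆ r : ℝ, ENNReal.ofReal (r * s - φ x r)

open Filter Topology in
theorem aemeasurable_comp_of_ae_continuous {μ : Measure Ω} {f : Ω → ℝ → ℝ}
    (hf : ∀ r : ℝ, Measurable fun x => f x r) (hc : ∀ᵐ x ∂μ, Continuous (f x))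
    {u : Ω → ℝ} (hu : Measurable u) : AEMeasurable (fun x => f x (u x)) μ := by
  have hus := hu.stronglyMeasurable
  refine aemeasurable_of_tendsto_metrizable_ae atTop (f := fun n x => f x (hus.approx n x))
    (fun n => ?_) ?_
  · exact ((hus.approx n).measurable_bind (fun r x => f x r) hf).aemeasurable
  · filter_upwards [hc] with x hx
    exact (hx.tendsto _).comp (hus.tendsto_approx x)

theorem apply_abs_of_even {f : ℝ → ℝ} (heven : ∀ r, f (-r) = f r) (t : ℝ) : f |t| = f t := by
  rcases abs_choice t with h | h <;> simp [h, heven]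

omit [MeasurableSpace Ω] in
/-- Equality in the Fenchel-Young inequality at a subgradient. -/
theorem conjFn2_abs_eq {φ : Ω → ℝ → ℝ} {x : Ω} {a t : ℝ} (heven : ∀ r, φ x (-r) = φ x r)
    (hnn : 0 ≤ a * t) (hsub : ∀ r, a * (r - t) ≤ φ x r - φ x t) :
    conjFn2 φ x |a| = ENNReal.ofReal (a * t - φ x t) := by
  apply le_antisymm
  · refine iSup_le fun r => ENNReal.ofReal_le_ofReal ?_
    rcases abs_choice a with h | h <;> rw [h]
    · linarith [hsub r]
    · have := hsub (-r)
      rw [heven] at this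
      linarith
  · refine le_iSup_of_le |t| (ENNReal.ofReal_le_ofReal ?_)
    rw [apply_abs_of_even heven, ← abs_mul, mul_comm t a, abs_of_nonneg hnn]

/-- if `α(x,·) ∈ ∂φ(x,·)` is a Carathéodory selection of the
subdifferential of an even convex Δ₂-function `φ` with `φ(x,0)=0`, and `u` has finite
modular, then `ξ := α(·,u)` satisfies: `ξ·u ≥ 0` a.e. and
`∫ ξ u ≤ (K−1) ∫ φ(x,|u|)` (in particular `ξ u` is integrable), and
`∫ φ*(x,|ξ|) = ∫ ξ u − ∫ φ(x,|u|) < +∞`. -/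
theorem stmt10 (μ : Measure Ω) (φ : Ω → ℝ → ℝ) (α : Ω → ℝ → ℝ) (K : ℝ)
    (hK : 2 ≤ K)
    (hφ : ∀ᵐ x ∂μ, ConvexOn ℝ Set.univ (φ x) ∧ (∀ r : ℝ, φ x (-r) = φ x r) ∧
      φ x 0 = 0 ∧ (∀ r : ℝ, 0 ≤ φ x r) ∧ (∀ r : ℝ, 0 ≤ r → φ x (2 * r) ≤ K * φ x r))
    (hφmeas : ∀ r : ℝ, Measurable fun x => φ x r)
    (hαmeas : ∀ r : ℝ, Measurable fun x => α x r)
    (hαcont : ∀ᵐ x ∂μ, Continuous (α x))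
    (hsub : ∀ᵐ x ∂μ, ∀ r r' : ℝ, α x r * (r' - r) ≤ φ x r' - φ x r)
    (u : Ω → ℝ) (humeas : Measurable u)
    (hufin : ∫⁻ x, ENNReal.ofReal (φ x |u x|) ∂μ < ⊤) :
    (∀ᵐ x ∂μ, 0 ≤ α x (u x) * u x) ∧
    (∫⁻ x, ENNReal.ofReal (α x (u x) * u x) ∂μ ≤
      ENNReal.ofReal (K - 1) * ∫⁻ x, ENNReal.ofReal (φ x |u x|) ∂μ) ∧
    (∫⁻ x, ENNReal.ofReal (α x (u x) * u x) ∂μ < ⊤) ∧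
    (∫⁻ x, conjFn2 φ x |α x (u x)| ∂μ + ∫⁻ x, ENNReal.ofReal (φ x |u x|) ∂μ =
      ∫⁻ x, ENNReal.ofReal (α x (u x) * u x) ∂μ) ∧
    (∫⁻ x, conjFn2 φ x |α x (u x)| ∂μ < ⊤) := by
  have hpt : ∀ᵐ x ∂μ, 0 ≤ φ x |u x| ∧ φ x |u x| ≤ α x (u x) * u x ∧
      α x (u x) * u x ≤ (K - 1) * φ x |u x| ∧
      conjFn2 φ x |α x (u x)| = ENNReal.ofReal (α x (u x) * u x - φ x |u x|) := by
    filter_upwards [hφ, hsub] with x ⟨_, heven, h0, hnn, hΔ⟩ hs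
    have h1 := hs (u x) 0
    have h2 := hs (u x) (2 * u x)
    have h3 := hΔ |u x| (abs_nonneg _)
    have h4 : φ x (2 * |u x|) = φ x (2 * u x) := by
      rw [← apply_abs_of_even heven (2 * u x), abs_mul, abs_two]
    have h5 := hnn (u x)
    rw [h4] at h3
    rw [apply_abs_of_even heven] at h3 ⊢
    have h6 : φ x (u x) ≤ α x (u x) * u x := by linarith
    exact ⟨h5, h6, by linarith, conjFn2_abs_eq heven (h5.trans h6) (hs (u x))⟩
  have hmeas : AEMeasurable (fun x => ENNReal.ofReal (φ x |u x|)) μ := by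
    refine (aemeasurable_comp_of_ae_continuous hφmeas ?_ humeas.abs).ennreal_ofReal
    filter_upwards [hφ] with x hx
    exact continuousOn_univ.1 (hx.1.continuousOn isOpen_univ)
  have hle : ∫⁻ x, ENNReal.ofReal (α x (u x) * u x) ∂μ ≤
      ENNReal.ofReal (K - 1) * ∫⁻ x, ENNReal.ofReal (φ x |u x|) ∂μ := by
    rw [← lintegral_const_mul' _ _ ENNReal.ofReal_ne_top]
    refine lintegral_mono_ae ?_
    filter_upwards [hpt] with x hx
    rw [← ENNReal.ofReal_mul (by linarith)]
    exact ENNReal.ofReal_le_ofReal hx.2.2.1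
  have hlt := hle.trans_lt (ENNReal.mul_lt_top ENNReal.ofReal_lt_top hufin)
  have heq : ∫⁻ x, conjFn2 φ x |α x (u x)| ∂μ + ∫⁻ x, ENNReal.ofReal (φ x |u x|) ∂μ =
      ∫⁻ x, ENNReal.ofReal (α x (u x) * u x) ∂μ := by
    rw [← lintegral_add_right' _ hmeas]
    refine lintegral_congr_ae ?_
    filter_upwards [hpt] with x ⟨h0, h1, _, h3⟩
    rw [h3, ← ENNReal.ofReal_add (sub_nonneg.2 h1) h0, sub_add_cancel]
  refine ⟨?_, hle, hlt, heq, (le_self_add.trans_eq heq).trans_lt hlt⟩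
  filter_upwards [hpt] with x hx using hx.1.trans hx.2.1
end
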